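/- arXiv:2101.06180 — 3 statements merged into one kernel-verified Lean document; each statement's English description precedes it below -/
import Mathlib

section
/- For every forest F (a finite simple graph with no cycles), c₂(F) = mr(F, F₂). -/
open Matrix

/-- A subgraph complementation system for `G`: a finite collection (multiset) of subsets of
vertices such that two distinct vertices are adjacent iff they lie together in an odd
number of the sets. -/
def IsSCS {V : Type*} [DecidableEq V] (G : SimpleGraph V) (𝒞 : Multiset (Finset V)) : Prop :=
  ∀ u v : V, u ≠ v →
    (G.Adj u v ↔ Odd (Multiset.card (𝒞.filter (fun C => u ∈ C ∧ v ∈ C))))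

/-- The subgraph complementation number `c₂(G)`: the minimum cardinality of a subgraph
complementation system for `G`. -/
noncomputable def c2 {V : Type*} [DecidableEq V] (G : SimpleGraph V) : ℕ :=
  sInf {k | ∃ 𝒞 : Multiset (Finset V), IsSCS G 𝒞 ∧ Multiset.card 𝒞 = k}

/-- A symmetric matrix over `F₂` fits `G` if its off-diagonal entries record adjacency. -/
def FitsF2 {V : Type*} (G : SimpleGraph V) (A : Matrix V V (ZMod 2)) : Prop :=
  A.IsSymm ∧ ∀ u v : V, u ≠ v → (A u v = 1 ↔ G.Adj u v)

/-- The minimum rank of `G` over `F₂`: the minimum rank of a symmetric matrix over `F₂`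
that fits `G`. -/
noncomputable def mrF2 {V : Type*} [Fintype V] (G : SimpleGraph V) : ℕ :=
  sInf {k | ∃ A : Matrix V V (ZMod 2), FitsF2 G A ∧ A.rank = k}

theorem stmt14_leaf {V : Type*} [Fintype V] (F : SimpleGraph V) (hF : F.IsAcyclic)
    {a b : V} (hab : F.Adj a b) : ∃ v u, F.Adj v u ∧ ∀ w, F.Adj v w → w = u := by
  classical
  obtain ⟨x, y, p, hp, hmax⟩ : ∃ x y, ∃ p : F.Walk x y, p.IsPath ∧
      ∀ x' y' (q : F.Walk x' y'), q.IsPath → q.length ≤ p.length := by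
    let S : Set ℕ := {n | ∃ x y, ∃ p : F.Walk x y, p.IsPath ∧ p.length = n}
    have hfin : S.Finite := by
      apply (Set.finite_lt_nat (Fintype.card V)).subset
      rintro n ⟨x, y, p, hp, rfl⟩
      exact hp.length_lt
    have hne : S.Nonempty := ⟨0, a, a, SimpleGraph.Walk.nil, by simp, rfl⟩
    obtain ⟨m, ⟨x, y, p, hp, rfl⟩, hm⟩ := Set.exists_max_image S id hfin hne
    exact ⟨x, y, p, hp, fun x' y' q hq => hm _ ⟨x', y', q, hq, rfl⟩⟩
  have h1 : 1 ≤ p.length := by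
    have := hmax a b hab.toWalk (by simp [hab.ne])
    simpa using this
  have hnn : ¬ p.Nil := by
    rw [← SimpleGraph.Walk.length_eq_zero_iff]; omega
  refine ⟨x, p.snd, p.adj_snd hnn, fun w hw => ?_⟩
  by_cases hws : w ∈ p.support
  · exact hF.eq_snd_of_adj_start hp hw hws
  · have := hmax _ _ (SimpleGraph.Walk.cons hw.symm p) (by simp [hp, hws])
    simp at this

theorem stmt14_z2 (a : ZMod 2) : a = 0 ∨ a = 1 := by revert a; decide

theorem stmt14_rank_lt {V : Type*} [Fintype V] [DecidableEq V] (A : Matrix V V (ZMod 2))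
    (hA : A.IsSymm) (x : V → ZMod 2) (hx : x ⬝ᵥ (A *ᵥ x) = 1) :
    (A + vecMulVec (A *ᵥ x) (A *ᵥ x)).rank < A.rank := by
  set B := A + vecMulVec (A *ᵥ x) (A *ᵥ x) with hB
  have key : ∀ z, B *ᵥ z = A *ᵥ z + (x ⬝ᵥ (A *ᵥ z)) • (A *ᵥ x) := by
    intro z
    have : (A *ᵥ x) ⬝ᵥ z = x ⬝ᵥ (A *ᵥ z) := by
      rw [dotProduct_mulVec, ← mulVec_transpose, hA.eq]
    rw [hB, add_mulVec, vecMulVec_mulVec, this]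
    simp
  have hlt : LinearMap.ker A.mulVecLin < LinearMap.ker B.mulVecLin := by
    refine lt_of_le_of_ne ?_ ?_
    · intro z hz
      simp only [LinearMap.mem_ker, mulVecLin_apply] at hz ⊢
      rw [key, hz]; simp
    · intro h
      have : x ∈ LinearMap.ker B.mulVecLin := by
        simp only [LinearMap.mem_ker, mulVecLin_apply]
        rw [key, hx, one_smul]
        ext i
        exact CharTwo.add_self_eq_zero _
      rw [← h] at this
      simp only [LinearMap.mem_ker, mulVecLin_apply] at this
      rw [this] at hx
      simp at hx
  have h1 := Submodule.finrank_lt_finrank_of_lt hlt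
  have h2 := LinearMap.finrank_range_add_finrank_ker A.mulVecLin
  have h3 := LinearMap.finrank_range_add_finrank_ker B.mulVecLin
  unfold Matrix.rank
  omega

theorem stmt14_choose {V : Type*} [Fintype V] [DecidableEq V] (A : Matrix V V (ZMod 2))
    (hA : A.IsSymm) (hd : ∃ i, A i i = 1) :
    ∃ x : V → ZMod 2, x ⬝ᵥ (A *ᵥ x) = 1 ∧
      (A + vecMulVec (A *ᵥ x) (A *ᵥ x) = 0 ∨
        ∃ k, (A + vecMulVec (A *ᵥ x) (A *ᵥ x)) k k = 1) := by
  obtain ⟨i, hi⟩ := hd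
  by_cases h : (A + vecMulVec (A *ᵥ Pi.single i 1) (A *ᵥ Pi.single i 1) = 0 ∨
        ∃ k, (A + vecMulVec (A *ᵥ Pi.single i 1) (A *ᵥ Pi.single i 1)) k k = 1)
  · exact ⟨Pi.single i 1, by simp [hi], h⟩
  push Not at h
  obtain ⟨h0, hk⟩ := h
  have hdiag : ∀ k, A k k = A k i := by
    intro k
    have := hk k
    simp [vecMulVec_apply] at this
    revert this
    generalize A k k = a
    generalize A k i = b
    revert a b
    decide
  obtain ⟨k, j, hkj⟩ : ∃ k j, A k j + A k i * A j i = 1 := by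
    by_contra hcon
    push Not at hcon
    apply h0
    ext k j
    have := (stmt14_z2 (A k j + A k i * A j i)).resolve_right (hcon k j)
    simpa [vecMulVec_apply] using this
  have hsym : ∀ p q, A p q = A q p := fun p q => hA.apply q p
  have hmv : ∀ l, (A *ᵥ (Pi.single j 1 + (1 + A j i) • Pi.single i 1)) l
      = A l j + (1 + A j i) * A l i := by
    intro l
    simp [mulVec_add, mulVec_smul]
  refine ⟨Pi.single j 1 + (1 + A j i) • Pi.single i 1, ?_, Or.inr ⟨k, ?_⟩⟩
  · rw [add_dotProduct, smul_dotProduct, single_one_dotProduct, single_one_dotProduct, hmv, hmv,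
      hdiag j, hi, hsym i j, smul_eq_mul]
    generalize A j i = a
    revert a
    decide
  · rw [Matrix.add_apply, vecMulVec_apply, hmv, hdiag k]
    revert hkj
    generalize A k j = a
    generalize A k i = b
    generalize A j i = c
    revert a b c
    decide

theorem stmt14_lempel {V : Type*} [Fintype V] [DecidableEq V] (n : ℕ) :
    ∀ A : Matrix V V (ZMod 2), A.IsSymm → A.rank ≤ n → (A = 0 ∨ ∃ i, A i i = 1) →
    ∃ 𝒞 : Multiset (Finset V), Multiset.card 𝒞 ≤ n ∧
      ∀ u v, A u v = (Multiset.card (𝒞.filter (fun C => u ∈ C ∧ v ∈ C)) : ZMod 2) := by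
  induction n with
  | zero =>
    rintro A hA hr (rfl | hd)
    · exact ⟨0, by simp, by simp⟩
    · obtain ⟨x, hx, -⟩ := stmt14_choose A hA hd
      have := stmt14_rank_lt A hA x hx
      omega
  | succ n ih =>
    rintro A hA hr (rfl | hd)
    · exact ⟨0, by simp, by simp⟩
    · obtain ⟨x, hx, hB⟩ := stmt14_choose A hA hd
      have hlt := stmt14_rank_lt A hA x hx
      obtain ⟨𝒞, hc, h𝒞⟩ := ih _ (by
        rw [IsSymm, transpose_add, hA.eq, transpose_vecMulVec]) (by omega) hB
      refine ⟨(Finset.univ.filter fun u => (A *ᵥ x) u = 1) ::ₘ 𝒞, by simpa using hc, ?_⟩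
      intro u v
      have h := h𝒞 u v
      rw [Matrix.add_apply, vecMulVec_apply] at h
      rw [Multiset.filter_cons, Multiset.card_add, Nat.cast_add, ← h]
      simp only [Finset.mem_filter, Finset.mem_univ, true_and]
      generalize (A *ᵥ x) u = a
      generalize (A *ᵥ x) v = b
      generalize A u v = c
      rcases stmt14_z2 a with rfl | rfl <;> rcases stmt14_z2 b with rfl | rfl <;> simp
      rw [add_comm c, ← add_assoc, CharTwo.add_self_eq_zero, zero_add]

theorem stmt14_rank_add {V : Type*} [Fintype V] (A B : Matrix V V (ZMod 2)) :
    (A + B).rank ≤ A.rank + B.rank := by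
  unfold Matrix.rank
  refine le_trans (Submodule.finrank_mono ?_)
    (Submodule.finrank_add_le_finrank_add_finrank
      (LinearMap.range A.mulVecLin) (LinearMap.range B.mulVecLin))
  rintro _ ⟨x, rfl⟩
  rw [Matrix.mulVecLin_add]
  exact Submodule.add_mem_sup ⟨x, rfl⟩ ⟨x, rfl⟩

theorem stmt14_rank_le {V : Type*} [Fintype V] [DecidableEq V] (𝒞 : Multiset (Finset V)) :
    (Matrix.of fun u v =>
      (Multiset.card (𝒞.filter (fun C => u ∈ C ∧ v ∈ C)) : ZMod 2)).rank ≤ Multiset.card 𝒞 := by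
  induction 𝒞 using Multiset.induction_on with
  | empty =>
    have : (Matrix.of fun u v : V => (Multiset.card ((0 : Multiset (Finset V)).filter
      (fun C => u ∈ C ∧ v ∈ C)) : ZMod 2)) = 0 := by ext; simp
    rw [this]; simp
  | cons C 𝒞 ih =>
    have : (Matrix.of fun u v : V => (Multiset.card ((C ::ₘ 𝒞).filter
      (fun C => u ∈ C ∧ v ∈ C)) : ZMod 2)) =
      vecMulVec (fun u => if u ∈ C then 1 else 0) (fun u => if u ∈ C then 1 else 0) +
      (Matrix.of fun u v : V => (Multiset.card (𝒞.filter
      (fun C => u ∈ C ∧ v ∈ C)) : ZMod 2)) := by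
      ext u v
      simp only [of_apply, Matrix.add_apply, vecMulVec_apply, Multiset.filter_cons,
        Multiset.card_add, Nat.cast_add]
      by_cases hu : u ∈ C <;> by_cases hv : v ∈ C <;> simp [hu, hv]
    rw [this, Multiset.card_cons]
    have h1 := Matrix.rank_vecMulVec_le (fun u => if u ∈ C then (1 : ZMod 2) else 0)
      (fun u => if u ∈ C then (1 : ZMod 2) else 0)
    refine (stmt14_rank_add _ _).trans ?_
    omega

theorem stmt14_nonalt {V : Type*} [Fintype V] [DecidableEq V] (F : SimpleGraph V)
    (hF : F.IsAcyclic) (A : Matrix V V (ZMod 2)) (hA : FitsF2 F A) :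
    ∃ A' : Matrix V V (ZMod 2), FitsF2 F A' ∧ A'.rank ≤ A.rank ∧ (A' = 0 ∨ ∃ i, A' i i = 1) := by
  by_cases hd : A = 0 ∨ ∃ i, A i i = 1
  · exact ⟨A, hA, le_rfl, hd⟩
  push Not at hd
  obtain ⟨h0, hd⟩ := hd
  have hz : ∀ i, A i i = 0 := fun i => (stmt14_z2 _).resolve_right (hd i)
  obtain ⟨a, b, hab⟩ : ∃ a b, A a b = 1 := by
    by_contra hcon
    push Not at hcon
    apply h0
    ext a b
    exact (stmt14_z2 _).resolve_right (hcon a b)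
  have hne : a ≠ b := by rintro rfl; exact hd _ hab
  obtain ⟨v, u, hvu, huniq⟩ := stmt14_leaf F hF ((hA.2 a b hne).1 hab)
  have hrow : ∀ w, A v w = if w = u then 1 else 0 := by
    intro w
    split_ifs with hw
    · subst hw; exact (hA.2 _ _ hvu.ne).2 hvu
    · by_cases hvw : v = w
      · subst hvw; exact hz v
      · exact (stmt14_z2 _).resolve_right fun h => hw (huniq _ ((hA.2 _ _ hvw).1 h))
  have heq : A + Matrix.single u u 1 = (1 + Matrix.single u v 1) * A := by
    rw [add_mul, one_mul]
    congr 1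
    ext p q
    by_cases hp : p = u
    · subst hp
      rw [Matrix.single_mul_apply_same, hrow, one_mul, Matrix.single_apply]
      simp [eq_comm]
    · rw [Matrix.single_mul_apply_of_ne _ _ _ _ _ hp, Matrix.single_apply, if_neg]
      rintro ⟨h, -⟩; exact hp h.symm
  refine ⟨A + Matrix.single u u 1, ⟨?_, ?_⟩, ?_, Or.inr ⟨u, ?_⟩⟩
  · rw [IsSymm, transpose_add, hA.1.eq, transpose_single]
  · intro p q hpq
    rw [Matrix.add_apply, Matrix.single_apply, if_neg, add_zero]
    · exact hA.2 p q hpq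
    · rintro ⟨rfl, rfl⟩; exact hpq rfl
  · rw [heq]; exact Matrix.rank_mul_le_right _ _
  · rw [Matrix.add_apply, hz]; simp

theorem stmt14 {V : Type*} [Fintype V] [DecidableEq V] (F : SimpleGraph V)
    (hF : F.IsAcyclic) :
    c2 F = mrF2 F := by
  have hupper : ∃ 𝒞 : Multiset (Finset V), IsSCS F 𝒞 ∧ Multiset.card 𝒞 ≤ mrF2 F := by
    have hne : {k | ∃ A : Matrix V V (ZMod 2), FitsF2 F A ∧ A.rank = k}.Nonempty := by
      classical
      refine ⟨_, F.adjMatrix (ZMod 2), ⟨F.isSymm_adjMatrix, ?_⟩, rfl⟩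
      intro u v _
      simp [SimpleGraph.adjMatrix_apply]
    obtain ⟨A, hA, hr⟩ := Nat.sInf_mem hne
    obtain ⟨A', hA', hr', hd⟩ := stmt14_nonalt F hF A hA
    obtain ⟨𝒞, hc, h⟩ := stmt14_lempel A'.rank A' hA'.1 le_rfl hd
    refine ⟨𝒞, ?_, ?_⟩
    · intro u v huv
      rw [← hA'.2 u v huv, h, ZMod.natCast_eq_one_iff_odd]
    · unfold mrF2; omega
  obtain ⟨𝒞, h𝒞, hc⟩ := hupper
  unfold mrF2 at hc ⊢
  unfold c2
  apply le_antisymm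
  · refine le_trans (Nat.sInf_le ?_) hc
    exact ⟨𝒞, h𝒞, rfl⟩
  · obtain ⟨𝒟, h𝒟, hd⟩ := Nat.sInf_mem
      (s := {k | ∃ 𝒞 : Multiset (Finset V), IsSCS F 𝒞 ∧ Multiset.card 𝒞 = k}) ⟨_, 𝒞, h𝒞, rfl⟩
    rw [← hd]
    refine le_trans (Nat.sInf_le ?_) (stmt14_rank_le 𝒟)
    refine ⟨_, ⟨?_, ?_⟩, rfl⟩
    · ext u v
      simp only [transpose_apply, of_apply, and_comm]
    · intro u v huv
      rw [h𝒟 u v huv, of_apply, ZMod.natCast_eq_one_iff_odd]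
end

section
/- For every forest F (a finite simple graph with no cycles) on n vertices, c₂(F) = n − p(F), where p(F) is the path cover number of F. -/
open Matrix

/-- A graph is a path graph if it is a connected acyclic graph of maximum degree at most 2
(a single vertex counts as a path on one vertex). -/
def IsPathGraph {W : Type*} (H : SimpleGraph W) : Prop :=
  H.Connected ∧ H.IsAcyclic ∧ ∀ w : W, (H.neighborSet w).ncard ≤ 2

/-- The path cover number `p(G)`: the minimum number of parts in a partition of the vertex
set into sets each of which induces a path in `G`. -/
noncomputable def pathCoverNumber {V : Type*} [Fintype V] [DecidableEq V]
    (G : SimpleGraph V) : ℕ :=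
  sInf {k | ∃ P : Finset (Finset V),
    (∀ S ∈ P, ∀ T ∈ P, S ≠ T → Disjoint S T) ∧
    (∀ v : V, ∃ S ∈ P, v ∈ S) ∧
    (∀ S ∈ P, IsPathGraph (G.induce (S : Set V))) ∧
    P.card = k}


section helpers

lemma rank_lt_aux {V : Type*} [Fintype V] [DecidableEq V] (A B : Matrix V V (ZMod 2))
    (h : ∀ z, A *ᵥ z = 0 → B *ᵥ z = 0) (w : V → ZMod 2) (hB : B *ᵥ w = 0) (hA : A *ᵥ w ≠ 0) :
    B.rank + 1 ≤ A.rank := by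
  have h1 := LinearMap.finrank_range_add_finrank_ker A.mulVecLin
  have h2 := LinearMap.finrank_range_add_finrank_ker B.mulVecLin
  have h3 : LinearMap.ker A.mulVecLin < LinearMap.ker B.mulVecLin := by
    refine lt_of_le_of_ne (fun z hz => ?_) (fun he => hA ?_)
    · simp only [LinearMap.mem_ker, Matrix.mulVecLin_apply] at hz ⊢
      exact h z hz
    · have : w ∈ LinearMap.ker A.mulVecLin := by
        rw [he]; simpa using hB
      simpa using this
  have h4 := Submodule.finrank_lt_finrank_of_lt h3
  unfold Matrix.rank
  omega

def zeroAt {V : Type*} [DecidableEq V] (A : Matrix V V (ZMod 2)) (v : V) :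
    Matrix V V (ZMod 2) := Matrix.of fun i j => if i = v ∨ j = v then 0 else A i j

lemma rank_zeroAt_le {V : Type*} [Fintype V] [DecidableEq V] (A : Matrix V V (ZMod 2)) (v : V) :
    (zeroAt A v).rank ≤ A.rank := by
  have : zeroAt A v = Matrix.diagonal (fun i => if i = v then 0 else 1) *
      (A * Matrix.diagonal (fun i => if i = v then 0 else 1)) := by
    ext i j
    simp only [zeroAt, Matrix.of_apply, Matrix.diagonal_mul, Matrix.mul_diagonal]
    by_cases h1 : i = v <;> by_cases h2 : j = v <;> simp [h1, h2]
  rw [this]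
  exact (Matrix.rank_mul_le_right _ _).trans (Matrix.rank_mul_le_left _ _)

lemma rank_zeroAt_add_two {V : Type*} [Fintype V] [DecidableEq V] (A : Matrix V V (ZMod 2))
    (a v : V) (hrow : ∀ j, A a j = if j = v then 1 else 0)
    (hcol : ∀ j, A j a = if j = v then 1 else 0) (hav : a ≠ v) :
    (zeroAt A v).rank + 2 ≤ A.rank := by
  let B : Matrix V V (ZMod 2) := Matrix.of fun i j => if i = v then 0 else A i j
  have h1 : B.rank + 1 ≤ A.rank := by
    refine rank_lt_aux A B (fun z hz => ?_) (Pi.single a 1) ?_ ?_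
    · ext i
      by_cases hi : i = v
      · simp [B, Matrix.mulVec, dotProduct, hi]
      · have := congrFun hz i
        simpa [B, Matrix.mulVec, dotProduct, hi] using this
    · ext i
      by_cases hi : i = v <;> simp [B, hi, hcol]
    · intro h
      have := congrFun h v
      simp [hcol] at this
  have h2 : (zeroAt A v).rank + 1 ≤ B.rank := by
    refine rank_lt_aux B _ (fun z hz => ?_) (Pi.single v 1) ?_ ?_
    · have hz0 : z v = 0 := by
        have := congrFun hz a
        simpa [B, Matrix.mulVec, dotProduct, hav, hrow] using this
      ext i
      have := congrFun hz i
      rw [← this]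
      simp only [B, Matrix.mulVec, dotProduct, zeroAt, Matrix.of_apply]
      refine Finset.sum_congr rfl fun j _ => ?_
      by_cases hj : j = v
      · simp [hj, hz0]
      · simp [hj]
    · ext i
      simp [zeroAt]
    · intro h
      have := congrFun h a
      simp [B, hav, hrow] at this
  omega

lemma rank_schur {V : Type*} [Fintype V] [DecidableEq V] (A : Matrix V V (ZMod 2))
    (hs : A.IsSymm) (a : V) (ha : A a a = 1) :
    (A - Matrix.vecMulVec (A a) (A a)).rank + 1 ≤ A.rank := by
  refine rank_lt_aux A _ (fun z hz => ?_) (Pi.single a 1) ?_ ?_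
  · have h0 : A a ⬝ᵥ z = 0 := congrFun hz a
    rw [Matrix.sub_mulVec, hz, Matrix.vecMulVec_mulVec, h0]; simp
  · ext i
    have := hs.apply a i
    simp [Matrix.vecMulVec_apply, ha, this]
  · intro h
    have := congrFun h a
    simp [ha] at this

lemma rank_add_vecMulVec {V : Type*} [Fintype V] [DecidableEq V] (A : Matrix V V (ZMod 2))
    (u : V → ZMod 2) : (A + Matrix.vecMulVec u u).rank ≤ A.rank + 1 :=
by
  have h1 : (A + Matrix.vecMulVec u u).rank ≤ A.rank + (Matrix.vecMulVec u u).rank := by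
    unfold Matrix.rank
    rw [Matrix.mulVecLin_add]
    exact (Submodule.finrank_mono (LinearMap.range_add_le _ _)).trans
      (Submodule.finrank_add_le_finrank_add_finrank _ _)
  exact h1.trans (Nat.add_le_add_left (Matrix.rank_vecMulVec_le _ _) _)

def scsMat {V : Type*} [DecidableEq V] (C : Multiset (Finset V)) : Matrix V V (ZMod 2) :=
  Matrix.of fun u v => ((Multiset.card (C.filter (fun S => u ∈ S ∧ v ∈ S)) : ℕ) : ZMod 2)

lemma scsMat_cons {V : Type*} [DecidableEq V] (S : Finset V) (C : Multiset (Finset V)) :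
    scsMat (S ::ₘ C) = scsMat C + Matrix.vecMulVec (fun u => if u ∈ S then 1 else 0)
      (fun u => if u ∈ S then 1 else 0) := by
  ext u v
  by_cases h : u ∈ S <;> by_cases h' : v ∈ S <;>
    simp [scsMat, Matrix.vecMulVec_apply, Multiset.filter_cons, h, h', add_comm]

lemma rank_scsMat {V : Type*} [Fintype V] [DecidableEq V] (C : Multiset (Finset V)) :
    (scsMat C).rank ≤ Multiset.card C := by
  induction C using Multiset.induction_on with
  | empty =>
    have : scsMat (0 : Multiset (Finset V)) = 0 := by ext; simp [scsMat]
    simp [this]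
  | cons S C ih =>
    rw [scsMat_cons, Multiset.card_cons]
    exact (rank_add_vecMulVec _ _).trans (by omega)

lemma fits_scsMat {V : Type*} [DecidableEq V] (G : SimpleGraph V)
    (C : Multiset (Finset V)) (h : IsSCS G C) : FitsF2 G (scsMat C) := by
  refine ⟨?_, fun u v huv => ?_⟩
  · ext u v
    simp [scsMat, and_comm]
  · rw [h u v huv, ← ZMod.natCast_eq_one_iff_odd]; rfl

lemma odd_cons {V : Type*} [DecidableEq V] (S : Finset V) (C : Multiset (Finset V)) (u v : V) :
    Odd (Multiset.card ((S ::ₘ C).filter (fun S => u ∈ S ∧ v ∈ S))) ↔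
      ¬ (Odd (Multiset.card (C.filter (fun S => u ∈ S ∧ v ∈ S))) ↔ (u ∈ S ∧ v ∈ S)) := by
  by_cases h : u ∈ S ∧ v ∈ S
  · rw [Multiset.filter_cons_of_pos (a := S) (p := fun S => u ∈ S ∧ v ∈ S) C h, Multiset.card_cons, Nat.odd_add_one]; simp only [h]; tauto
  · rw [Multiset.filter_cons_of_neg (a := S) (p := fun S => u ∈ S ∧ v ∈ S) C h]; simp only [h]; tauto

/-- `a` is a leaf with unique neighbour `v`. -/
def LeafAt {V : Type*} (G : SimpleGraph V) (a v : V) : Prop :=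
  G.Adj a v ∧ ∀ x, G.Adj a x → x = v

lemma degree_comp {V : Type*} [Fintype V] (G : SimpleGraph V) (c : G.ConnectedComponent)
    (x : c) : (c.toSimpleGraph.neighborSet x).ncard = (G.neighborSet x.1).ncard := by
  rw [← Set.ncard_image_of_injective _ Subtype.val_injective]
  congr 1
  ext y
  simp only [Set.mem_image, SimpleGraph.mem_neighborSet, Subtype.exists, exists_and_right,
    exists_eq_right]
  constructor
  · rintro ⟨hy, h⟩
    exact h
  · intro h
    exact ⟨by
      have := x.2
      change G.connectedComponentMk _ = c at this
      change G.connectedComponentMk _ = c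
      rw [← this]
      exact SimpleGraph.ConnectedComponent.sound h.symm.reachable, h⟩

lemma sum_ncard {V : Type*} [Fintype V] (G : SimpleGraph V) :
    ∑ v, (G.neighborSet v).ncard = 2 * G.edgeSet.ncard := by
  classical
  have := G.sum_degrees_eq_twice_card_edges
  rw [Set.ncard_eq_toFinset_card' G.edgeSet]
  rw [SimpleGraph.edgeFinset] at this
  rw [← this]
  refine Finset.sum_congr rfl fun v _ => ?_
  rw [Set.ncard_eq_toFinset_card']
  rfl

lemma tree_edges {V : Type*} [Fintype V] (G : SimpleGraph V) (h : G.IsTree) :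
    G.edgeSet.ncard + 1 = Fintype.card V := by
  classical
  rw [← h.card_edgeFinset, Set.ncard_eq_toFinset_card' G.edgeSet]
  rfl

lemma forest_edges {V : Type*} [Fintype V] (G : SimpleGraph V) (h : G.IsAcyclic) :
    G.edgeSet.ncard + Nat.card G.ConnectedComponent = Fintype.card V := by
  classical
  have key : ∀ c : G.ConnectedComponent,
      (∑ x : c, (G.neighborSet x.1).ncard) + 2 = ∑ x : c, 2 := by
    intro c
    have h1 := tree_edges _ (h.isTree_connectedComponent c)
    have h2 := sum_ncard c.toSimpleGraph
    have h3 : ∑ x : c, (G.neighborSet x.1).ncard =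
        ∑ x : c, (c.toSimpleGraph.neighborSet x).ncard :=
      Finset.sum_congr rfl fun x _ => (degree_comp G c x).symm
    rw [h3]
    have h4 : ∑ x : c, 2 = Fintype.card c * 2 := by simp
    rw [h4]
    have h5 : ∑ x : c, (c.toSimpleGraph.neighborSet x).ncard =
      2 * c.toSimpleGraph.edgeSet.ncard := h2
    have h6 : c.toSimpleGraph.edgeSet.ncard + 1 = Fintype.card c := h1
    omega
  have fib : ∀ f : V → ℕ, ∑ c : G.ConnectedComponent, ∑ x : c, f x.1 = ∑ v, f v := by
    intro f
    rw [← Finset.sum_fiberwise (s := Finset.univ) (g := fun v => G.connectedComponentMk v)]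
    refine Finset.sum_congr rfl fun c _ => ?_
    rw [Finset.sum_subtype (p := fun v => v ∈ c)]
    intro x
    simp only [Finset.mem_filter, Finset.mem_univ, true_and]
    rfl
  have h1 := Finset.sum_congr (rfl : (Finset.univ : Finset G.ConnectedComponent) = _) (fun c _ => key c)
  rw [Finset.sum_add_distrib, fib (fun v => (G.neighborSet v).ncard), fib (fun _ => 2),
    sum_ncard] at h1
  simp at h1
  rw [Nat.card_eq_fintype_card]
  omega

lemma exists_leaf {V : Type*} [Fintype V] (G : SimpleGraph V) (h : G.IsAcyclic)
    {u w : V} (huw : G.Adj u w) : ∃ a v, LeafAt G a v := by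
  classical
  let c := G.connectedComponentMk u
  have hu : u ∈ c.supp := rfl
  have hw : w ∈ c.supp := SimpleGraph.ConnectedComponent.sound huw.symm.reachable
  have : Nontrivial c := ⟨⟨⟨u, hu⟩, ⟨w, hw⟩, fun he => huw.ne (congrArg Subtype.val he)⟩⟩
  have ht := h.isTree_connectedComponent c
  obtain ⟨x, hx⟩ := SimpleGraph.IsTree.exists_vert_degree_one_of_nontrivial (V := c) ht
  have h1 : (c.toSimpleGraph.neighborSet x).ncard = 1 := by
    rw [Set.ncard_eq_toFinset_card', ← hx, Set.toFinset_card, SimpleGraph.card_neighborSet_eq_degree]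
  rw [degree_comp, Set.ncard_eq_one] at h1
  obtain ⟨v, hv⟩ := h1
  refine ⟨x.1, v, ?_, fun y hy => ?_⟩
  · have : v ∈ G.neighborSet x.1 := by rw [hv]; rfl
    exact this
  · have : y ∈ G.neighborSet x.1 := hy
    rw [hv] at this
    exact this

/-- A forest with an edge has a vertex `v` with a leaf neighbour such that all neighbours of `v`
but at most one are leaves. -/
lemma exists_good {V : Type*} [Fintype V] (G : SimpleGraph V) (h : G.IsAcyclic)
    {u w : V} (huw : G.Adj u w) :
    ∃ a v, LeafAt G a v ∧ ∃ y, ∀ x, G.Adj v x → x = y ∨ LeafAt G x v := by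
  classical
  let K : SimpleGraph V :=
    { Adj := fun x y => G.Adj x y ∧ (∀ z, ¬ LeafAt G x z) ∧ (∀ z, ¬ LeafAt G y z)
      symm := ⟨fun x y hxy => ⟨hxy.1.symm, hxy.2.2, hxy.2.1⟩⟩
      loopless := ⟨fun x hx => G.loopless.irrefl x hx.1⟩ }
  have hK : K ≤ G := fun x y hxy => hxy.1
  by_cases hE : ∃ x y, K.Adj x y
  · obtain ⟨x, y, hxy⟩ := hE
    obtain ⟨v, y, hvy, hv⟩ := exists_leaf K (h.anti hK) hxy
    have hall : ∀ x, G.Adj v x → x = y ∨ LeafAt G x v := by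
      intro x hx
      by_cases hl : ∀ z, ¬ LeafAt G x z
      · exact Or.inl (hv x ⟨hx, hvy.2.1, hl⟩)
      · push Not at hl
        obtain ⟨z, hz⟩ := hl
        have := hz.2 v hx.symm
        subst this
        exact Or.inr hz
    have hn : ¬ LeafAt G v y := hvy.2.1 y
    have : ∃ a, G.Adj v a ∧ a ≠ y := by
      by_contra hc
      push Not at hc
      exact hn ⟨hvy.1, hc⟩
    obtain ⟨a, ha, hay⟩ := this
    exact ⟨a, v, (hall a ha).resolve_left hay, y, hall⟩
  · push Not at hE
    obtain ⟨a, v, hav⟩ := exists_leaf G h huw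
    refine ⟨a, v, hav, ?_⟩
    by_cases hl : ∃ z, LeafAt G v z
    · obtain ⟨z, hz⟩ := hl
      exact ⟨z, fun x hx => Or.inl (hz.2 x hx)⟩
    · push Not at hl
      refine ⟨a, fun x hx => ?_⟩
      right
      have := hE v x
      by_cases hl' : ∀ z, ¬ LeafAt G x z
      · exact absurd ⟨hx, hl, hl'⟩ this
      · push Not at hl'
        obtain ⟨z, hz⟩ := hl'
        have := hz.2 v hx.symm
        subst this
        exact hz

lemma zmod2_ne_one {x : ZMod 2} (h : x ≠ 1) : x = 0 := by
  revert x; decide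

lemma fits_apply {V : Type*} {G : SimpleGraph V} {A : Matrix V V (ZMod 2)} (h : FitsF2 G A)
    {u v : V} (huv : u ≠ v) [Decidable (G.Adj u v)] : A u v = if G.Adj u v then 1 else 0 := by
  split_ifs with hh
  · exact (h.2 u v huv).2 hh
  · exact zmod2_ne_one fun h1 => hh ((h.2 u v huv).1 h1)

lemma fits_zeroAt {V : Type*} [DecidableEq V] {G : SimpleGraph V} {A : Matrix V V (ZMod 2)}
    (h : FitsF2 G A) (v : V) : FitsF2 (G.deleteIncidenceSet v) (zeroAt A v) := by
  refine ⟨?_, fun u w huw => ?_⟩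
  · ext i j
    simp only [zeroAt, Matrix.transpose_apply, Matrix.of_apply, h.1.apply i j, or_comm]
  · rw [SimpleGraph.deleteIncidenceSet_adj, ← h.2 u w huw]
    by_cases h1 : u = v <;> by_cases h2 : w = v <;> simp [zeroAt, h1, h2]

lemma leaf_row {V : Type*} [DecidableEq V] {G : SimpleGraph V} {A : Matrix V V (ZMod 2)}
    (h : FitsF2 G A) {a v : V} (hl : LeafAt G a v) (j : V) (hj : j ≠ a) :
    A a j = if j = v then 1 else 0 := by
  classical
  rw [fits_apply h hj.symm]
  by_cases hv : j = v
  · subst hv; simp [hl.1]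
  · simp only [hv, if_false, ite_eq_right_iff]
    intro hh; exact absurd (hl.2 _ hh) hv

lemma fits_schur {V : Type*} [DecidableEq V] {G : SimpleGraph V} {A : Matrix V V (ZMod 2)}
    (h : FitsF2 G A) {a v : V} (hl : LeafAt G a v) (ha : A a a = 1) :
    FitsF2 (G.deleteEdges {s(a, v)}) (A - Matrix.vecMulVec (A a) (A a)) := by
  refine ⟨?_, fun u w huw => ?_⟩
  · ext i j
    simp only [Matrix.transpose_apply, Matrix.sub_apply, Matrix.vecMulVec_apply, h.1.apply i j,
      mul_comm]
  · have hav := hl.1.ne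
    have hval : ∀ j, A a j = if j = a ∨ j = v then 1 else 0 := by
      intro j
      by_cases hj : j = a
      · simp [hj, ha]
      · rw [leaf_row h hl j hj]; simp [hj]
    rw [SimpleGraph.deleteEdges_adj, Matrix.sub_apply, Matrix.vecMulVec_apply, hval, hval,
      ← h.2 u w huw]
    by_cases hc : s(u, w) = s(a, v)
    · have : A u w = 1 := by
        rw [h.2 u w huw]
        rcases Sym2.eq_iff.1 hc with ⟨rfl, rfl⟩ | ⟨rfl, rfl⟩
        · exact hl.1
        · exact hl.1.symm
      have h2 : (u = a ∨ u = v) ∧ (w = a ∨ w = v) := by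
        rcases Sym2.eq_iff.1 hc with ⟨rfl, rfl⟩ | ⟨rfl, rfl⟩ <;> simp
      simp [hc, this, h2.1, h2.2]
    · have h2 : ¬ ((u = a ∨ u = v) ∧ (w = a ∨ w = v)) := by
        rintro ⟨rfl | rfl, rfl | rfl⟩
        · exact huw rfl
        · exact hc rfl
        · exact hc Sym2.eq_swap
        · exact huw rfl
      have h3 : ((if u = a ∨ u = v then 1 else 0) * (if w = a ∨ w = v then 1 else 0) : ZMod 2) = 0 := by
        by_cases h4 : u = a ∨ u = v
        · have : ¬ (w = a ∨ w = v) := fun h5 => h2 ⟨h4, h5⟩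
          rw [if_neg this, mul_zero]
        · rw [if_neg h4, zero_mul]
      rw [h3]
      simp [hc]

def Core {V : Type*} [Fintype V] [DecidableEq V] (F : SimpleGraph V) (k : ℕ) : Prop :=
  (∃ H ≤ F, (∀ w, (H.neighborSet w).ncard ≤ 2) ∧ H.edgeSet.ncard = k) ∧
  (∃ C, IsSCS F C ∧ Multiset.card C = k) ∧
  (∀ H ≤ F, (∀ w, (H.neighborSet w).ncard ≤ 2) → H.edgeSet.ncard ≤ k) ∧
  (∀ A, FitsF2 F A → k ≤ A.rank)

lemma ncard_sup_edge {V : Type*} [Fintype V] (H : SimpleGraph V) {a v : V} (hav : a ≠ v)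
    (h : ¬ H.Adj a v) : (H ⊔ SimpleGraph.edge a v).edgeSet.ncard = H.edgeSet.ncard + 1 := by
  rw [SimpleGraph.edgeSet_sup, SimpleGraph.edge_edgeSet_of_ne hav, Set.union_singleton,
    Set.ncard_insert_of_notMem (by simpa using h)]

lemma ncard_le_two_of {V : Type*} {s : Set V} (x y : V) (h : ∀ z ∈ s, z = x ∨ z = y) :
    s.ncard ≤ 2 :=
  (Set.ncard_le_ncard (t := {x, y}) (fun z hz => h z hz) (Set.toFinite _)).trans
    ((Set.ncard_insert_le x {y}).trans (by simp))

lemma core_caseA {V : Type*} [Fintype V] [DecidableEq V] (F : SimpleGraph V) {a b v : V}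
    (hab : a ≠ b) (ha : LeafAt F a v) (hb : LeafAt F b v) (k : ℕ)
    (hk : Core (F.deleteIncidenceSet v) k) : Core F (k + 2) := by
  classical
  obtain ⟨⟨H, hHF, hH2, hHk⟩, ⟨C, hC, hCk⟩, hup, hrk⟩ := hk
  have hav := ha.1.ne
  have hbv := hb.1.ne
  refine ⟨?_, ?_, ?_, ?_⟩
  · have hadj : ∀ x y, H.Adj x y → F.Adj x y ∧ x ≠ v ∧ y ≠ v := fun x y hxy =>
      SimpleGraph.deleteIncidenceSet_adj.1 (hHF hxy)
    have hna : ∀ y, ¬ H.Adj a y := fun y hy => (hadj _ _ hy).2.2 (ha.2 _ (hadj _ _ hy).1)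
    have hnb : ∀ y, ¬ H.Adj b y := fun y hy => (hadj _ _ hy).2.2 (hb.2 _ (hadj _ _ hy).1)
    have hnv : ∀ y, ¬ H.Adj v y := fun y hy => (hadj _ _ hy).2.1 rfl
    refine ⟨(H ⊔ SimpleGraph.edge a v) ⊔ SimpleGraph.edge b v, ?_, ?_, ?_⟩
    · refine sup_le (sup_le (hHF.trans (SimpleGraph.deleteIncidenceSet_le F v)) ?_) ?_
      · exact (SimpleGraph.edge_le_iff F).2 (Or.inr ha.1)
      · exact (SimpleGraph.edge_le_iff F).2 (Or.inr hb.1)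
    · intro w
      by_cases hwv : w = v
      · refine ncard_le_two_of a b fun z hz => ?_
        subst hwv
        simp only [SimpleGraph.mem_neighborSet, SimpleGraph.sup_adj, SimpleGraph.edge_adj] at hz
        have := hnv z
        grind
      by_cases hwab : w = a ∨ w = b
      · refine ncard_le_two_of v v fun z hz => ?_
        simp only [SimpleGraph.mem_neighborSet, SimpleGraph.sup_adj, SimpleGraph.edge_adj] at hz
        have := hna z
        have := hnb z
        grind
      · refine le_trans (Set.ncard_le_ncard (fun z hz => ?_) (Set.toFinite _)) (hH2 w)
        simp only [SimpleGraph.mem_neighborSet, SimpleGraph.sup_adj, SimpleGraph.edge_adj] at hz ⊢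
        grind
    · rw [ncard_sup_edge _ hbv, ncard_sup_edge _ hav (hna v), hHk]
      simp only [SimpleGraph.sup_adj, SimpleGraph.edge_adj]
      have := hnb v
      grind
  · refine ⟨insert v (Finset.univ.filter (F.Adj v)) ::ₘ (Finset.univ.filter (F.Adj v)) ::ₘ C,
      ?_, by simp [hCk]⟩
    intro x y hxy
    rw [odd_cons, odd_cons, ← hC x y hxy, SimpleGraph.deleteIncidenceSet_adj]
    simp only [Finset.mem_insert, Finset.mem_filter, Finset.mem_univ, true_and]
    have h1 := F.loopless.irrefl v
    by_cases hx : x = v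
    · subst hx
      have : y ≠ x := Ne.symm hxy
      tauto
    · by_cases hy : y = v
      · subst hy
        rw [F.adj_comm x y]
        tauto
      · tauto
  · intro H hHF hH2
    have h1 := hup (H.deleteIncidenceSet v) (fun x y hxy => by
      rw [SimpleGraph.deleteIncidenceSet_adj] at hxy ⊢
      exact ⟨hHF hxy.1, hxy.2⟩) (fun w => le_trans (Set.ncard_le_ncard (fun z hz =>
        SimpleGraph.deleteIncidenceSet_le H v hz) (Set.toFinite _)) (hH2 w))
    have h2 : H.edgeSet ⊆ (H.deleteIncidenceSet v).edgeSet ∪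
        (fun x => s(v, x)) '' H.neighborSet v := by
      intro e
      induction e using Sym2.ind with
      | _ x y =>
        intro he
        simp only [SimpleGraph.mem_edgeSet] at he
        by_cases hx : x = v
        · subst hx
          exact Or.inr ⟨y, he, rfl⟩
        · by_cases hy : y = v
          · subst hy
            exact Or.inr ⟨x, he.symm, Sym2.eq_swap⟩
          · left
            simp only [SimpleGraph.mem_edgeSet, SimpleGraph.deleteIncidenceSet_adj]
            exact ⟨he, hx, hy⟩
    have h3 := Set.ncard_le_ncard h2 (Set.toFinite _)
    have h4 := Set.ncard_union_le (H.deleteIncidenceSet v).edgeSet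
      ((fun x => s(v, x)) '' H.neighborSet v)
    have h5 := Set.ncard_image_le (f := fun x => s(v, x)) (Set.toFinite (H.neighborSet v))
    have h6 := hH2 v
    omega
  · intro A hA
    have zero_case : ∀ c, LeafAt F c v → A c c = 0 → k + 2 ≤ A.rank := by
      intro c hc h0
      have hrow : ∀ j, A c j = if j = v then 1 else 0 := by
        intro j
        by_cases hj : j = c
        · subst hj; simp [h0, hc.1.ne]
        · exact leaf_row hA hc j hj
      have := rank_zeroAt_add_two A c v hrow (fun j => by rw [hA.1.apply c j]; exact hrow j) hc.1.ne
      have := hrk _ (fits_zeroAt hA v)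
      omega
    by_cases ha1 : A a a = 1
    · by_cases hb1 : A b b = 1
      · have hB := fits_schur hA ha ha1
        have r1 := rank_schur A hA.1 a ha1
        set B := A - Matrix.vecMulVec (A a) (A a) with hBdef
        have hb' : LeafAt (F.deleteEdges {s(a, v)}) b v := by
          refine ⟨?_, fun x hx => hb.2 x (SimpleGraph.deleteEdges_le _ hx)⟩
          rw [SimpleGraph.deleteEdges_adj]
          refine ⟨hb.1, ?_⟩
          simp only [Set.mem_singleton_iff, Sym2.eq_iff]
          grind
        have hBb : B b b = 1 := by
          rw [hBdef, Matrix.sub_apply, Matrix.vecMulVec_apply, leaf_row hA ha b hab.symm]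
          simp [hbv, hb1]
        have hD := fits_schur hB hb' hBb
        have r2 := rank_schur B hB.1 b hBb
        have hZ := fits_zeroAt hD v
        have hG : ((F.deleteEdges {s(a, v)}).deleteEdges {s(b, v)}).deleteIncidenceSet v =
            F.deleteIncidenceSet v := by
          ext x y
          simp only [SimpleGraph.deleteIncidenceSet_adj, SimpleGraph.deleteEdges_adj,
            Set.mem_singleton_iff, Sym2.eq_iff]
          grind
        rw [hG] at hZ
        have r3 := hrk _ hZ
        have r4 := rank_zeroAt_le (B - Matrix.vecMulVec (B b) (B b)) v
        omega
      · exact zero_case b hb (zmod2_ne_one hb1)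
    · exact zero_case a ha (zmod2_ne_one ha1)

lemma core_caseB {V : Type*} [Fintype V] [DecidableEq V] (F : SimpleGraph V) {a v y : V}
    (ha : LeafAt F a v) (hv : ∀ x, F.Adj v x → x = y ∨ x = a) (k : ℕ)
    (hk : Core (F.deleteEdges {s(a, v)}) k) : Core F (k + 1) := by
  classical
  obtain ⟨⟨H, hHF, hH2, hHk⟩, ⟨C, hC, hCk⟩, hup, hrk⟩ := hk
  have hav := ha.1.ne
  have hF1 : ∀ x y, (F.deleteEdges {s(a, v)}).Adj x y ↔
      F.Adj x y ∧ ¬ (x = a ∧ y = v ∨ x = v ∧ y = a) := by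
    intro x y
    rw [SimpleGraph.deleteEdges_adj, Set.mem_singleton_iff, Sym2.eq_iff]
  refine ⟨?_, ?_, ?_, ?_⟩
  · have hadj : ∀ x y, H.Adj x y → F.Adj x y ∧ ¬ (x = a ∧ y = v ∨ x = v ∧ y = a) :=
      fun x y hxy => (hF1 x y).1 (hHF hxy)
    have hna : ∀ y, ¬ H.Adj a y := fun y hy =>
      (hadj _ _ hy).2 (Or.inl ⟨rfl, ha.2 _ (hadj _ _ hy).1⟩)
    refine ⟨H ⊔ SimpleGraph.edge a v, ?_, ?_, ?_⟩
    · exact sup_le (hHF.trans (SimpleGraph.deleteEdges_le _))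
        ((SimpleGraph.edge_le_iff F).2 (Or.inr ha.1))
    · intro w
      by_cases hwv : w = v
      · refine ncard_le_two_of y a fun z hz => ?_
        subst hwv
        simp only [SimpleGraph.mem_neighborSet, SimpleGraph.sup_adj, SimpleGraph.edge_adj] at hz
        have := hadj w z
        have := hv z
        grind
      by_cases hwab : w = a
      · refine ncard_le_two_of v v fun z hz => ?_
        simp only [SimpleGraph.mem_neighborSet, SimpleGraph.sup_adj, SimpleGraph.edge_adj] at hz
        have := hna z
        grind
      · refine le_trans (Set.ncard_le_ncard (fun z hz => ?_) (Set.toFinite _)) (hH2 w)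
        simp only [SimpleGraph.mem_neighborSet, SimpleGraph.sup_adj, SimpleGraph.edge_adj] at hz ⊢
        grind
    · rw [ncard_sup_edge _ hav (hna v), hHk]
  · refine ⟨{a, v} ::ₘ C, ?_, by simp [hCk]⟩
    intro x y hxy
    rw [odd_cons, ← hC x y hxy, hF1]
    simp only [Finset.mem_insert, Finset.mem_singleton]
    have h1 := ha.1
    have h2 := ha.1.symm
    grind
  · intro H hHF hH2
    have h1 := hup (H.deleteEdges {s(a, v)}) (SimpleGraph.deleteEdges_mono hHF) (fun w =>
      le_trans (Set.ncard_le_ncard (fun z hz =>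
        SimpleGraph.deleteEdges_le _ hz) (Set.toFinite _)) (hH2 w))
    rw [SimpleGraph.edgeSet_deleteEdges] at h1
    have := Set.le_ncard_sdiff {s(a, v)} H.edgeSet (Set.toFinite _)
    rw [Set.ncard_singleton] at this
    omega
  · intro A hA
    by_cases ha1 : A a a = 1
    · have := rank_schur A hA.1 a ha1
      have := hrk _ (fits_schur hA ha ha1)
      omega
    · have h0 := zmod2_ne_one ha1
      have hrow : ∀ j, A a j = if j = v then 1 else 0 := by
        intro j
        by_cases hj : j = a
        · subst hj; simp [h0, hav]
        · exact leaf_row hA ha j hj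
      have r1 := rank_zeroAt_add_two A a v hrow
        (fun j => by rw [hA.1.apply a j]; exact hrow j) hav
      have hZ := fits_zeroAt hA v
      set Z := zeroAt A v
      let u : V → ZMod 2 := fun x => if x = v ∨ (F.deleteEdges {s(a, v)}).Adj v x then 1 else 0
      have r2 := rank_add_vecMulVec Z u
      have hfit : FitsF2 (F.deleteEdges {s(a, v)}) (Z + Matrix.vecMulVec u u) := by
        refine ⟨?_, fun x w hxw => ?_⟩
        · ext i j
          simp only [Matrix.transpose_apply, Matrix.add_apply, Matrix.vecMulVec_apply,
            hZ.1.apply i j, mul_comm]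
        · rw [Matrix.add_apply, Matrix.vecMulVec_apply, fits_apply hZ hxw]
          simp only [SimpleGraph.deleteIncidenceSet_adj, u, hF1]
          have l := F.loopless.irrefl v
          by_cases hx : x = v
          · subst hx
            have : w ≠ x := hxw.symm
            simp [this]
          · by_cases hw : w = v
            · subst hw
              simp [hx]
              rw [F.adj_comm x w]
              tauto
            · have hnot : ¬ (F.Adj v x ∧ ¬ x = a) ∨ ¬ (F.Adj v w ∧ ¬ w = a) := by
                by_contra hcon
                push Not at hcon
                have e1 := (hv x hcon.1.1).resolve_right hcon.1.2
                have e2 := (hv w hcon.2.1).resolve_right hcon.2.2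
                exact hxw (e1.trans e2.symm)
              have hprod : ((if x = v ∨ F.Adj v x ∧ ¬ (v = a ∧ x = v ∨ True ∧ x = a) then 1 else 0) *
                 (if w = v ∨ F.Adj v w ∧ ¬ (v = a ∧ w = v ∨ True ∧ w = a) then 1 else 0) : ZMod 2)
                  = 0 := by
                simp only [hx, hw, false_or, and_false, true_and]
                rcases hnot with h | h
                · rw [if_neg h, zero_mul]
                · rw [if_neg h, mul_zero]
              rw [hprod]
              simp [hx, hw]
      have r3 := hrk _ hfit
      omega

lemma core_exists {V : Type*} [Fintype V] [DecidableEq V] (n : ℕ) : ∀ F : SimpleGraph V,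
    F.IsAcyclic → F.edgeSet.ncard = n → ∃ k, Core F k := by
  induction n using Nat.strong_induction_on with
  | _ n ih =>
    intro F hF hn
    by_cases hE : ∃ u w, F.Adj u w
    · obtain ⟨u, w, huw⟩ := hE
      obtain ⟨a, v, ha, y, hy⟩ := exists_good F hF huw
      by_cases hb : ∃ b, a ≠ b ∧ LeafAt F b v
      · obtain ⟨b, hab, hb⟩ := hb
        have hle := SimpleGraph.deleteIncidenceSet_le F v
        have hlt : (F.deleteIncidenceSet v).edgeSet.ncard < n := by
          rw [← hn]
          refine Set.ncard_lt_ncard ⟨SimpleGraph.edgeSet_mono hle, fun h => ?_⟩ (Set.toFinite _)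
          have := h (show s(a, v) ∈ F.edgeSet from ha.1)
          rw [SimpleGraph.mem_edgeSet, SimpleGraph.deleteIncidenceSet_adj] at this
          exact this.2.2 rfl
        obtain ⟨k, hk⟩ := ih _ hlt _ (hF.anti hle) rfl
        exact ⟨k + 2, core_caseA F hab ha hb k hk⟩
      · push Not at hb
        have hle := SimpleGraph.deleteEdges_le (G := F) {s(a, v)}
        have hlt : (F.deleteEdges {s(a, v)}).edgeSet.ncard < n := by
          rw [← hn]
          refine Set.ncard_lt_ncard ⟨SimpleGraph.edgeSet_mono hle, fun h => ?_⟩ (Set.toFinite _)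
          have := h (show s(a, v) ∈ F.edgeSet from ha.1)
          rw [SimpleGraph.mem_edgeSet, SimpleGraph.deleteEdges_adj] at this
          exact this.2 rfl
        obtain ⟨k, hk⟩ := ih _ hlt _ (hF.anti hle) rfl
        refine ⟨k + 1, core_caseB F ha (y := y) (fun x hx => ?_) k hk⟩
        rcases hy x hx with h | h
        · exact Or.inl h
        · right
          by_contra hne
          exact hb x (Ne.symm hne) h
    · push Not at hE
      have hbot : F = ⊥ := by
        ext u w; simp [hE u w]
      subst hbot
      refine ⟨0, ⟨⊥, le_rfl, by simp [SimpleGraph.neighborSet], by simp⟩, ⟨0, ?_, rfl⟩, ?_, by simp⟩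
      · intro u v _; simp
      · intro H hH _
        rw [le_bot_iff] at hH
        simp [hH]

lemma cover_of_sub {V : Type*} [Fintype V] [DecidableEq V] (F H : SimpleGraph V)
    (hF : F.IsAcyclic) (hHF : H ≤ F) (hH : ∀ w, (H.neighborSet w).ncard ≤ 2) :
    ∃ P : Finset (Finset V),
    (∀ S ∈ P, ∀ T ∈ P, S ≠ T → Disjoint S T) ∧
    (∀ v : V, ∃ S ∈ P, v ∈ S) ∧
    (∀ S ∈ P, IsPathGraph (F.induce (S : Set V))) ∧
    P.card + H.edgeSet.ncard = Fintype.card V := by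
  classical
  let f : H.ConnectedComponent → Finset V := fun c => c.supp.toFinset
  have hf : Function.Injective f := by
    intro c d hcd
    apply SimpleGraph.ConnectedComponent.supp_injective
    simpa [f] using hcd
  have hmem : ∀ c v, v ∈ f c ↔ H.connectedComponentMk v = c := by
    intro c v; simp [f]
  refine ⟨Finset.univ.image f, ?_, ?_, ?_, ?_⟩
  · intro S hS T hT hST
    simp only [Finset.mem_image, Finset.mem_univ, true_and] at hS hT
    obtain ⟨c, rfl⟩ := hS
    obtain ⟨d, rfl⟩ := hT
    rw [Finset.disjoint_left]
    intro x hx hx'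
    rw [hmem] at hx hx'
    exact hST (by rw [← hx, ← hx'])
  · intro v
    exact ⟨f (H.connectedComponentMk v), Finset.mem_image_of_mem _ (Finset.mem_univ _),
      (hmem _ _).2 rfl⟩
  · intro S hS
    simp only [Finset.mem_image, Finset.mem_univ, true_and] at hS
    obtain ⟨c, rfl⟩ := hS
    have hset : ((f c : Finset V) : Set V) = c.supp := by simp [f]
    rw [hset]
    refine ⟨?_, hF.induce _, ?_⟩
    · exact (SimpleGraph.ConnectedComponent.connected_toSimpleGraph c).mono
        (fun x y hxy => hHF hxy)
    · intro w
      rw [← Set.ncard_image_of_injective _ Subtype.val_injective]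
      refine le_trans (Set.ncard_le_ncard ?_ (Set.toFinite _)) (hH w.1)
      rintro _ ⟨y, hy, rfl⟩
      have hadj : F.Adj w.1 y.1 := hy
      by_contra hn
      have hb := (SimpleGraph.isAcyclic_iff_forall_adj_isBridge.1 hF) hadj
      rw [SimpleGraph.isBridge_iff] at hb
      apply hb
      have hr : H.Reachable w.1 y.1 :=
        SimpleGraph.ConnectedComponent.exact (w.2.trans y.2.symm)
      refine hr.mono fun p q hpq => ?_
      rw [SimpleGraph.deleteEdges_adj, Set.mem_singleton_iff]
      refine ⟨hHF hpq, fun he => hn ?_⟩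
      rcases Sym2.eq_iff.1 he with ⟨h1, h2⟩ | ⟨h1, h2⟩
      · rw [h1, h2] at hpq; exact hpq
      · rw [h1, h2] at hpq; exact hpq.symm
  · rw [Finset.card_image_of_injective _ hf, Finset.card_univ, ← Nat.card_eq_fintype_card, add_comm]
    exact forest_edges H (hF.anti hHF)

lemma sub_of_cover {V : Type*} [Fintype V] [DecidableEq V] (F : SimpleGraph V)
    (hF : F.IsAcyclic) (P : Finset (Finset V))
    (hdis : ∀ S ∈ P, ∀ T ∈ P, S ≠ T → Disjoint S T)
    (hcov : ∀ v : V, ∃ S ∈ P, v ∈ S)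
    (hpath : ∀ S ∈ P, IsPathGraph (F.induce (S : Set V))) :
    ∃ H ≤ F, (∀ w, (H.neighborSet w).ncard ≤ 2) ∧
      Fintype.card V ≤ P.card + H.edgeSet.ncard := by
  classical
  let H : SimpleGraph V :=
    { Adj := fun x y => F.Adj x y ∧ ∃ S ∈ P, x ∈ S ∧ y ∈ S
      symm := ⟨fun x y h => ⟨h.1.symm, by
        obtain ⟨S, hS, h1, h2⟩ := h.2
        exact ⟨S, hS, h2, h1⟩⟩⟩
      loopless := ⟨fun x h => F.loopless.irrefl x h.1⟩ }
  have hHF : H ≤ F := fun x y h => h.1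
  refine ⟨H, hHF, ?_, ?_⟩
  · intro w
    obtain ⟨S, hS, hw⟩ := hcov w
    have h1 := (hpath S hS).2.2 ⟨w, hw⟩
    rw [← Set.ncard_image_of_injective _ Subtype.val_injective] at h1
    refine le_trans (Set.ncard_le_ncard ?_ (Set.toFinite _)) h1
    rintro y ⟨hy, T, hT, hwT, hyT⟩
    have hST : S = T := by
      by_contra hne
      exact Finset.disjoint_left.1 (hdis S hS T hT hne) hw hwT
    subst hST
    exact ⟨⟨y, hyT⟩, hy, rfl⟩
  · rw [← forest_edges H (hF.anti hHF), add_comm]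
    refine Nat.add_le_add_right ?_ _
    have hne : ∀ S : P, ∃ v, v ∈ S.1 := fun S => by
      obtain ⟨v⟩ := (hpath S.1 S.2).1.nonempty
      exact ⟨v.1, v.2⟩
    choose g hg using hne
    have hsurj : Function.Surjective (fun S : P => H.connectedComponentMk (g S)) := by
      intro c
      induction c using SimpleGraph.ConnectedComponent.ind with
      | _ v =>
        obtain ⟨S, hS, hv⟩ := hcov v
        refine ⟨⟨S, hS⟩, SimpleGraph.ConnectedComponent.sound ?_⟩
        have hr := (hpath S hS).1.preconnected ⟨g ⟨S, hS⟩, hg ⟨S, hS⟩⟩ ⟨v, hv⟩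
        let φ : F.induce (S : Set V) →g H :=
          { toFun := Subtype.val
            map_rel' := fun {x y} hxy => ⟨hxy, S, hS, x.2, y.2⟩ }
        exact hr.map φ
    have := Nat.card_le_card_of_surjective _ hsurj
    simpa using this

end helpers

theorem stmt15 {V : Type*} [Fintype V] [DecidableEq V] (F : SimpleGraph V)
    (hF : F.IsAcyclic) :
    c2 F = Fintype.card V - pathCoverNumber F := by
  obtain ⟨k, ⟨H, hHF, hH2, hHk⟩, ⟨C, hC, hCk⟩, hup, hrk⟩ := core_exists _ F hF rfl
  have h1 : c2 F = k := by
    apply le_antisymm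
    · exact Nat.sInf_le ⟨C, hC, hCk⟩
    · refine le_csInf ⟨k, C, hC, hCk⟩ ?_
      rintro _ ⟨D, hD, rfl⟩
      exact (hrk _ (fits_scsMat F D hD)).trans (rank_scsMat D)
  obtain ⟨P, hP1, hP2, hP3, hP4⟩ := cover_of_sub F H hF hHF hH2
  have h2 : pathCoverNumber F = P.card := by
    apply le_antisymm
    · exact Nat.sInf_le ⟨P, hP1, hP2, hP3, rfl⟩
    · refine le_csInf ⟨_, P, hP1, hP2, hP3, rfl⟩ ?_
      rintro _ ⟨Q, hQ1, hQ2, hQ3, rfl⟩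
      obtain ⟨K, hKF, hK2, hKc⟩ := sub_of_cover F hF Q hQ1 hQ2 hQ3
      have := hup K hKF hK2
      omega
  rw [h1, h2]
  omega
end

section
/- For every odd natural number k and every finite simple graph G, c₂(G) ≤ k if and only if mr(G, F₂) ≤ k. -/
open Matrix

/-- sum of rank one symmetric matrices -/
def sqSum {V : Type*} (l : List (V → ZMod 2)) : Matrix V V (ZMod 2) :=
  fun u v => (l.map (fun x => x u * x v)).sum

/-- sum of hyperbolic pairs -/
def hypSum {V : Type*} (l : List ((V → ZMod 2) × (V → ZMod 2))) : Matrix V V (ZMod 2) :=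
  fun u v => (l.map (fun p => p.1 u * p.2 v + p.2 u * p.1 v)).sum

lemma sq_add_hyp {V : Type*} (l : List (V → ZMod 2)) (hl : l ≠ []) (x y : V → ZMod 2) :
    ∃ l' : List (V → ZMod 2), l'.length = l.length + 2 ∧
      ∀ u v, sqSum l' u v = sqSum l u v + (x u * y v + y u * x v) := by
  obtain ⟨z, t, rfl⟩ := List.exists_cons_of_ne_nil hl
  refine ⟨(fun u => x u + y u + z u) :: (fun u => x u + z u) :: (fun u => y u + z u) :: t,
    by simp, fun u v => ?_⟩
  simp only [sqSum, List.map_cons, List.sum_cons]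
  generalize (t.map (fun x => x u * x v)).sum = s
  generalize x u = a; generalize x v = b; generalize y u = c; generalize y v = d
  generalize z u = e; generalize z v = f
  have h2 : (2 : ZMod 2) = 0 := by decide
  linear_combination (a * b + c * d + e * f + a * f + c * f + e * b + e * d) * h2

lemma sq_add_hyps {V : Type*} (m : List ((V → ZMod 2) × (V → ZMod 2)))
    (l : List (V → ZMod 2)) (hl : l ≠ []) :
    ∃ l' : List (V → ZMod 2), l'.length = l.length + 2 * m.length ∧
      ∀ u v, sqSum l' u v = sqSum l u v + hypSum m u v := by
  induction m with
  | nil => exact ⟨l, by simp, by simp [hypSum]⟩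
  | cons p m ih =>
    obtain ⟨l1, h1, h2⟩ := ih
    have : l1 ≠ [] := by
      rintro rfl
      have := List.length_pos_of_ne_nil hl
      simp at h1; omega
    obtain ⟨l2, h3, h4⟩ := sq_add_hyp l1 this p.1 p.2
    refine ⟨l2, by simp; omega, fun u v => ?_⟩
    rw [h4, h2]; simp [hypSum]; ring

section
variable {V : Type*} [Fintype V] [DecidableEq V]

lemma col_mem (A : Matrix V V (ZMod 2)) (i : V) :
    (fun v => A v i) ∈ LinearMap.range A.mulVecLin := by
  rw [Matrix.range_mulVecLin]
  exact Submodule.subset_span ⟨i, rfl⟩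

lemma range_le (A : Matrix V V (ZMod 2)) (W : Submodule (ZMod 2) (V → ZMod 2))
    (h : ∀ i, (fun v => A v i) ∈ W) : LinearMap.range A.mulVecLin ≤ W := by
  rw [Matrix.range_mulVecLin, Submodule.span_le]
  rintro _ ⟨i, rfl⟩
  exact h i

lemma lt_aux (W : Submodule (ZMod 2) (V → ZMod 2)) (x : V → ZMod 2) (hx : x ∈ W) (i : V)
    (hi : x i = 1) :
    W ⊓ LinearMap.ker (LinearMap.proj (R := ZMod 2) (φ := fun _ : V => ZMod 2) i) < W := by
  refine lt_of_le_of_ne inf_le_left fun h => ?_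
  rw [← h] at hx
  have := hx.2
  simp [hi] at this

lemma rank_one_step (A : Matrix V V (ZMod 2)) (hA : A.IsSymm) (i : V) (hi : A i i = 1) :
    Matrix.rank (fun u v => A u v - A u i * A v i : Matrix V V (ZMod 2)) < A.rank := by
  refine lt_of_le_of_lt ?_ (Submodule.finrank_lt_finrank_of_lt
    (lt_aux (LinearMap.range A.mulVecLin) _ (col_mem A i) i hi))
  refine Submodule.finrank_mono (range_le _ _ fun w => ⟨?_, ?_⟩)
  · have := Submodule.sub_mem _ (col_mem A w) (Submodule.smul_mem _ (A w i) (col_mem A i))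
    refine (congrArg (· ∈ LinearMap.range A.mulVecLin) ?_).mpr this
    funext v; simp; ring
  · simp [hi, hA.apply w i]

lemma rank_two_step (A : Matrix V V (ZMod 2)) (hA : A.IsSymm) (i j : V) (hi : A i i = 0)
    (hj : A j j = 0) (hij : A i j = 1) :
    Matrix.rank (fun u v => A u v - (A u i * A v j + A u j * A v i) : Matrix V V (ZMod 2)) + 2
      ≤ A.rank := by
  have hji : A j i = 1 := by rw [hA.apply]; exact hij
  have h1 := lt_aux (LinearMap.range A.mulVecLin) _ (col_mem A j) i hij
  have h2 := lt_aux (LinearMap.range A.mulVecLin ⊓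
    LinearMap.ker (LinearMap.proj (R := ZMod 2) (φ := fun _ : V => ZMod 2) i))
    (fun v => A v i) ⟨col_mem A i, by simp [hi]⟩ j hji
  have h1' := Submodule.finrank_lt_finrank_of_lt h1
  have h2' := Submodule.finrank_lt_finrank_of_lt h2
  have h3 : Matrix.rank (fun u v => A u v - (A u i * A v j + A u j * A v i) :
      Matrix V V (ZMod 2)) ≤ Module.finrank (ZMod 2) ↥(LinearMap.range A.mulVecLin ⊓
      LinearMap.ker (LinearMap.proj (R := ZMod 2) (φ := fun _ : V => ZMod 2) i) ⊓
      LinearMap.ker (LinearMap.proj (R := ZMod 2) (φ := fun _ : V => ZMod 2) j)) :=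
    Submodule.finrank_mono (range_le _ _ fun w => ⟨⟨?_, ?_⟩, ?_⟩)
  · have h4 : Module.finrank (ZMod 2) (LinearMap.range A.mulVecLin) = A.rank := rfl
    exact (Nat.add_le_add_right h3 2).trans (by omega)
  · have := Submodule.sub_mem _ (col_mem A w) (Submodule.add_mem _
      (Submodule.smul_mem _ (A w j) (col_mem A i)) (Submodule.smul_mem _ (A w i) (col_mem A j)))
    refine (congrArg (· ∈ LinearMap.range A.mulVecLin) ?_).mpr this
    funext v; simp; ring
  · simp [hi, hij, hA.apply w i]
  · simp [hj, hji, hA.apply w j]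

lemma decomp (n : ℕ) : ∀ A : Matrix V V (ZMod 2), A.IsSymm → A.rank ≤ n →
    (∃ l : List (V → ZMod 2), l.length ≤ n ∧ ∀ u v, A u v = sqSum l u v) ∨
    (∃ m : List ((V → ZMod 2) × (V → ZMod 2)), 2 * m.length ≤ n ∧
      ∀ u v, A u v = hypSum m u v) := by
  induction n using Nat.strong_induction_on with
  | _ n ih =>
  intro A hA hr
  have z2 : ∀ a : ZMod 2, a ≠ 0 → a = 1 := by decide
  by_cases hd : ∃ i, A i i ≠ 0
  · obtain ⟨i, hi⟩ := hd
    have hi := z2 _ hi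
    have hs := rank_one_step A hA i hi
    rcases ih (n - 1) (by omega) (fun u v => A u v - A u i * A v i)
      (Matrix.IsSymm.ext fun u v => by
        change A v u - _ = A u v - _
        rw [hA.apply u v]; ring) (by omega)
      with ⟨l, hl, h⟩ | ⟨m, hm, h⟩
    · refine Or.inl ⟨(fun v => A v i) :: l, by simp; omega, fun u v => ?_⟩
      have := h u v
      simp only [sqSum, List.map_cons, List.sum_cons] at this ⊢
      rw [← this]; ring
    · obtain ⟨l', h1, h2⟩ := sq_add_hyps m [fun v => A v i] (by simp)
      refine Or.inl ⟨l', by simp at h1; omega, fun u v => ?_⟩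
      rw [h2, ← h u v]; simp [sqSum]
  push Not at hd
  by_cases h0 : ∃ i j, A i j ≠ 0
  · obtain ⟨i, j, hij⟩ := h0
    have hij := z2 _ hij
    have hs := rank_two_step A hA i j (hd i) (hd j) hij
    rcases ih (n - 2) (by omega) (fun u v => A u v - (A u i * A v j + A u j * A v i))
      (Matrix.IsSymm.ext fun u v => by
        change A v u - _ = A u v - _
        rw [hA.apply u v]; ring) (by omega)
      with ⟨l, hl, h⟩ | ⟨m, hm, h⟩
    · by_cases hl0 : l = []
      · subst hl0
        refine Or.inr ⟨[(fun v => A v i, fun v => A v j)], by simp; omega, fun u v => ?_⟩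
        have := h u v
        simp [sqSum, hypSum] at this ⊢
        linear_combination this
      · obtain ⟨l', h1, h2⟩ := sq_add_hyp l hl0 (fun v => A v i) (fun v => A v j)
        refine Or.inl ⟨l', by omega, fun u v => ?_⟩
        rw [h2, ← h u v]; ring
    · refine Or.inr ⟨(fun v => A v i, fun v => A v j) :: m, by simp; omega, fun u v => ?_⟩
      have := h u v
      simp only [hypSum, List.map_cons, List.sum_cons] at this ⊢
      rw [← this]; ring
  · push Not at h0
    exact Or.inl ⟨[], by simp, by simp [sqSum, h0]⟩

lemma decomp_odd (k : ℕ) (hk : Odd k) (A : Matrix V V (ZMod 2)) (hA : A.IsSymm)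
    (hr : A.rank ≤ k) :
    ∃ l : List (V → ZMod 2), l.length ≤ k ∧ ∀ u v, A u v = sqSum l u v := by
  rcases decomp k A hA hr with h | ⟨m, hm, h⟩
  · exact h
  · obtain ⟨l', h1, h2⟩ := sq_add_hyps m [fun _ => 0] (by simp)
    obtain ⟨c, rfl⟩ := hk
    refine ⟨l', by simp at h1; omega, fun u v => ?_⟩
    rw [h2, ← h u v]; simp [sqSum]

lemma scs_of_fits (G : SimpleGraph V) (k : ℕ) (hk : Odd k) (A : Matrix V V (ZMod 2))
    (hA : FitsF2 G A) (hr : A.rank ≤ k) :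
    ∃ 𝒞 : Multiset (Finset V), IsSCS G 𝒞 ∧ Multiset.card 𝒞 ≤ k := by
  obtain ⟨l, hl, h⟩ := decomp_odd k hk A hA.1 hr
  refine ⟨((l.map fun x => Finset.univ.filter fun v => x v = 1 : List (Finset V)) :
    Multiset (Finset V)), fun u v huv => ?_, by simpa using hl⟩
  rw [← hA.2 u v huv, h, ← ZMod.natCast_eq_one_iff_odd]
  suffices hh : sqSum l u v = _ by rw [hh]
  clear h hl
  have key : ∀ a b : ZMod 2, a * b = if a = 1 ∧ b = 1 then 1 else 0 := by decide
  induction l with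
  | nil => simp [sqSum]
  | cons x t ih =>
    simp only [sqSum, List.map_cons, List.sum_cons] at ih ⊢
    rw [ih, ← Multiset.cons_coe, Multiset.filter_cons, key]
    split_ifs <;> simp_all [add_comm]

/-- the matrix of a system -/
def cMat (𝒞 : Multiset (Finset V)) : Matrix V V (ZMod 2) :=
  fun u v => ((Multiset.card (𝒞.filter (fun C => u ∈ C ∧ v ∈ C)) : ℕ) : ZMod 2)

lemma rank_add_le_aux (A B : Matrix V V (ZMod 2)) : (A + B).rank ≤ A.rank + B.rank :=
  (Submodule.finrank_mono (range_le (A + B)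
    (LinearMap.range A.mulVecLin ⊔ LinearMap.range B.mulVecLin)
    fun i => Submodule.add_mem_sup (col_mem A i) (col_mem B i))).trans
    (Submodule.finrank_add_le_finrank_add_finrank _ _)

lemma fits_of_scs (G : SimpleGraph V) (𝒞 : Multiset (Finset V)) (h : IsSCS G 𝒞) :
    ∃ A : Matrix V V (ZMod 2), FitsF2 G A ∧ A.rank ≤ Multiset.card 𝒞 := by
  refine ⟨cMat 𝒞, ⟨?_, fun u v huv => ?_⟩, ?_⟩
  · exact Matrix.IsSymm.ext fun u v => by simp only [cMat, and_comm]
  · rw [h u v huv, cMat, ZMod.natCast_eq_one_iff_odd]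
  · clear h
    induction 𝒞 using Multiset.induction_on with
    | empty =>
      have : cMat (0 : Multiset (Finset V)) = 0 := by
        ext; simp [cMat]
      rw [this, Matrix.rank_zero]; simp
    | cons C s ih =>
      have : cMat (C ::ₘ s) =
          Matrix.vecMulVec (fun u => if u ∈ C then 1 else 0) (fun u => if u ∈ C then 1 else 0)
          + cMat s := by
        ext u v
        rw [Matrix.add_apply, Matrix.vecMulVec_apply, cMat, cMat, Multiset.filter_cons]
        split_ifs <;> simp_all [add_comm]
      rw [this]
      refine (rank_add_le_aux _ _).trans ?_
      have := Matrix.rank_vecMulVec_le (fun u => if u ∈ C then (1 : ZMod 2) else 0)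
        (fun u => if u ∈ C then (1 : ZMod 2) else 0)
      simp only [Multiset.card_cons]
      omega

end

theorem stmt16 {V : Type*} [Fintype V] [DecidableEq V] (G : SimpleGraph V)
    (k : ℕ) (hk : Odd k) :
    c2 G ≤ k ↔ mrF2 G ≤ k := by
  classical
  have hne : {k | ∃ A : Matrix V V (ZMod 2), FitsF2 G A ∧ A.rank = k}.Nonempty :=
    ⟨_, G.adjMatrix (ZMod 2), ⟨G.isSymm_adjMatrix, fun u v _ => by simp⟩, rfl⟩
  constructor
  · intro h
    have hne2 : {k | ∃ 𝒞 : Multiset (Finset V), IsSCS G 𝒞 ∧ Multiset.card 𝒞 = k}.Nonempty := by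
      obtain ⟨r, A, hA, hr⟩ := hne
      obtain ⟨𝒞, h1, _⟩ := scs_of_fits G (2 * r + 1) ⟨r, rfl⟩ A hA (by omega)
      exact ⟨_, 𝒞, h1, rfl⟩
    obtain ⟨𝒞, h1, h2⟩ := Nat.sInf_mem hne2
    obtain ⟨A, hA, hr⟩ := fits_of_scs G 𝒞 h1
    have : mrF2 G ≤ A.rank := Nat.sInf_le ⟨A, hA, rfl⟩
    have h3 : Multiset.card 𝒞 = c2 G := h2
    omega
  · intro h
    obtain ⟨A, hA, hr⟩ := Nat.sInf_mem hne
    have h3 : A.rank = mrF2 G := hr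
    obtain ⟨𝒞, h1, h2⟩ := scs_of_fits G k hk A hA (by omega)
    have : c2 G ≤ Multiset.card 𝒞 := Nat.sInf_le ⟨𝒞, h1, rfl⟩
    omega
end
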